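/- Let G be an F_2-free split graph with split partition (K, I). If G contains an induced copy of Q with triangle T ⊆ K and its other three vertices in I, then every vertex of I has a non-neighbour in T. -/

import Mathlib

variable {V : Type*}

/-- `(K, I)` is a split partition of `G`: every vertex is in `K` or `I`, the sets are
disjoint, `K` is a clique and `I` is an independent set. -/
def IsSplitPartition (G : SimpleGraph V) (K I : Set V) : Prop :=
  (∀ v, v ∈ K ∨ v ∈ I) ∧ Disjoint K I ∧
  (∀ u ∈ K, ∀ v ∈ K, u ≠ v → G.Adj u v) ∧
  (∀ u ∈ I, ∀ v ∈ I, ¬ G.Adj u v)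

/-- `G` is `H`-free: there is no induced-subgraph embedding of `H` into `G`,
i.e. no induced subgraph of `G` is isomorphic to `H`. -/
def HFree {W : Type*} (G : SimpleGraph V) (H : SimpleGraph W) : Prop :=
  IsEmpty (H ↪g G)

/-- The bull: vertices a,b,c,d,e = 0,1,2,3,4 with edges ab, bc, ca, ad, be. -/
def bull : SimpleGraph (Fin 5) :=
  SimpleGraph.fromRel (fun u v =>
    (u, v) ∈ ([(0,1),(1,2),(2,0),(0,3),(1,4)] : List (Fin 5 × Fin 5)))

/-- The dart: vertices a,b,c,d,e = 0,1,2,3,4 with edges ab, bc, ca, ad, be, bd. -/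
def dart : SimpleGraph (Fin 5) :=
  SimpleGraph.fromRel (fun u v =>
    (u, v) ∈ ([(0,1),(1,2),(2,0),(0,3),(1,4),(1,3)] : List (Fin 5 × Fin 5)))

/-- `F₁`: a `K₄` on vertices a,b,c,d = 0,1,2,3, a vertex e = 4 adjacent only to a,
and a vertex f = 5 adjacent only to d. -/
def F1 : SimpleGraph (Fin 6) :=
  SimpleGraph.fromRel (fun u v =>
    (u, v) ∈ ([(0,1),(0,2),(0,3),(1,2),(1,3),(2,3),(0,4),(3,5)] : List (Fin 6 × Fin 6)))

/-- `F₂`: a `K₄` on vertices a,b,c,d = 0,1,2,3, a vertex e = 4 adjacent only to a,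
and a vertex f = 5 adjacent only to c and d. -/
def F2 : SimpleGraph (Fin 6) :=
  SimpleGraph.fromRel (fun u v =>
    (u, v) ∈ ([(0,1),(0,2),(0,3),(1,2),(1,3),(2,3),(0,4),(2,5),(3,5)] : List (Fin 6 × Fin 6)))

/-- `F₃`: a `K₄` on vertices a,b,c,d = 0,1,2,3, a vertex z = 4 adjacent only to a and b,
and a vertex y = 5 adjacent only to b. -/
def F3 : SimpleGraph (Fin 6) :=
  SimpleGraph.fromRel (fun u v =>
    (u, v) ∈ ([(0,1),(0,2),(0,3),(1,2),(1,3),(2,3),(0,4),(1,4),(1,5)] : List (Fin 6 × Fin 6)))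

/-- `Q`: vertices j1,j2,j3,i1,i2,i3 = 0,1,2,3,4,5 with edges
j1j2, j1j3, j2j3, i1j1, i2j2, i3j2, i3j3. -/
def Qgraph : SimpleGraph (Fin 6) :=
  SimpleGraph.fromRel (fun u v =>
    (u, v) ∈ ([(0,1),(0,2),(1,2),(3,0),(4,1),(5,1),(5,2)] : List (Fin 6 × Fin 6)))

/-- `K_{1,3} + 2P₁`: a star with centre 0 and leaves 1,2,3, plus isolated vertices 4,5. -/
def K13_2P1 : SimpleGraph (Fin 6) :=
  SimpleGraph.fromRel (fun u v =>
    (u, v) ∈ ([(0,1),(0,2),(0,3)] : List (Fin 6 × Fin 6)))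

/-- A module of `G`: every vertex outside `M` is adjacent to all of `M` or to none of it. -/
def IsModule (G : SimpleGraph V) (M : Set V) : Prop :=
  ∀ v ∉ M, (∀ u ∈ M, G.Adj v u) ∨ (∀ u ∈ M, ¬ G.Adj v u)

/-- `G` is prime: every module of `G` is trivial (has at most one vertex,
or is the whole vertex set). -/
def IsPrime (G : SimpleGraph V) : Prop :=
  ∀ M : Set V, IsModule G M → M.Subsingleton ∨ M = Set.univ

instance : DecidableRel F2.Adj := by unfold F2; infer_instance

instance : DecidableRel Qgraph.Adj := by unfold Qgraph; infer_instance

/-- No two vertices of `F₂` have the same neighbourhood, so a map from `F₂` that preserves and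
reflects adjacency is automatically an embedding. -/
theorem HFree.not_forall_adj_iff_of_F2 {G : SimpleGraph V} (hfree : HFree G F2) (g : Fin 6 → V) :
    ¬ ∀ u v, G.Adj (g u) (g v) ↔ F2.Adj u v := fun hg ↦ by
  have hF2 : ∀ u v, (∀ w, F2.Adj u w ↔ F2.Adj v w) → u = v := by decide
  have hinj : Function.Injective g := fun u v huv ↦ hF2 u v fun w ↦ by
    rw [← hg u w, ← hg v w, huv]
  exact hfree.false ⟨⟨g, hinj⟩, fun {u v} ↦ hg u v⟩

/-- Let `G` be an `F₂`-free split graph with split partition `(K, I)`. If `G` contains an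
induced copy of `Q` with triangle `T = {j1, j2, j3} = {0,1,2}` mapped into `K` and its other
three vertices mapped into `I`, then every vertex of `I` has a non-neighbour in `T`. -/
theorem F2_free_Q_nonneighbour_in_triangle (G : SimpleGraph V) (K I : Set V)
    (h : IsSplitPartition G K I) (hfree : HFree G F2)
    (f : Qgraph ↪g G) (h0 : f 0 ∈ K) (h1 : f 1 ∈ K) (h2 : f 2 ∈ K)
    (h3 : f 3 ∈ I) (h4 : f 4 ∈ I) (h5 : f 5 ∈ I) :
    ∀ x ∈ I, ∃ v ∈ ({f 0, f 1, f 2} : Set V), ¬ G.Adj x v := by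
  intro x hx
  by_contra! hT
  have x0 : G.Adj x (f 0) := hT _ (by simp)
  have x1 : G.Adj x (f 1) := hT _ (by simp)
  have x2 : G.Adj x (f 2) := hT _ (by simp)
  have x3 : ¬ G.Adj x (f 3) := h.2.2.2 x hx _ h3
  have x5 : ¬ G.Adj x (f 5) := h.2.2.2 x hx _ h5
  -- The clique of `F₂` is `j1, x, j2, j3`, and its pendant vertices are `i1` and `i3`.
  refine hfree.not_forall_adj_iff_of_F2 ![f 0, x, f 1, f 2, f 3, f 5] fun u v ↦ ?_
  fin_cases u <;> fin_cases v <;>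
    simp [x0, x1, x2, x3, x5, x0.symm, x1.symm, x2.symm, G.adj_comm _ x] <;> decide
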